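/- arXiv:1905.10882 — 2 statements merged into one kernel-verified Lean document; each statement's English description precedes it below -/
import Mathlib

section
/- The set L = {x ∈ ℝ : F(x, e^x) = 0 for some nonzero F ∈ ℚ[X,Y]} is not closed under addition. Specifically, ln 2 ∈ L, but assuming L is closed under addition leads to a contradiction with the Lindemann–Weierstrass theorem: it would force the transcendence degree of ℚ(√2, ln 2, e, e^{√2}) over ℚ to be 1, contradicting the algebraic independence of {e, e^{√2}} over ℚ. -/
/-- The set of real numbers `x` satisfying a nontrivial polynomial relation
`F(x, eˣ) = 0` with `F ∈ ℚ[X,Y]`. -/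
def Lset : Set ℝ :=
  {x : ℝ | ∃ F : MvPolynomial (Fin 2) ℚ, F ≠ 0 ∧ MvPolynomial.aeval ![x, Real.exp x] F = 0}



open NumberField in
/-- Invariant integral sum is an integer. -/
lemma lw_fixed_int (K : Type*) [Field K] [NumberField K] [IsGalois ℚ K] (x : 𝓞 K)
    (h : ∀ σ : K ≃ₐ[ℚ] K, σ • x = x) : ∃ m : ℤ, x = m := by
  have h1 : (x : K) ∈ Set.range (algebraMap ℚ K) := by
    rw [IsGalois.mem_range_algebraMap_iff_fixed]
    intro σ
    have := congrArg (algebraMap (𝓞 K) K) (h σ)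
    exact this
  obtain ⟨q, hq⟩ := h1
  have h2 : IsIntegral ℤ q := by
    have h3 : IsIntegral ℤ (algebraMap ℚ K q) := by rw [hq]; exact x.isIntegral_coe
    exact (isIntegral_algebraMap_iff (algebraMap ℚ K).injective).1 h3
  obtain ⟨m, hm⟩ := IsIntegrallyClosed.isIntegral_iff.1 h2
  refine ⟨m, ?_⟩
  apply RingOfIntegers.coe_injective
  change (x : K) = _
  rw [← hq, ← hm]
  simp

open NumberField in
lemma lw_analytic (K : Type*) [Field K] [NumberField K] [IsGalois ℚ K] (φ : K →+* ℂ)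
    (c : 𝓞 K →₀ ℤ) (hinv : ∀ (σ : K ≃ₐ[ℚ] K) (α : 𝓞 K), c (σ • α) = c α) (h0 : c 0 ≠ 0) :
    ∑ α ∈ c.support, (c α : ℂ) * Complex.exp (φ α) ≠ 0 := by
  classical
  intro hsum
  set s := c.support.erase 0 with hs
  have h0s : (0 : 𝓞 K) ∈ c.support := by simpa using h0
  rw [← Finset.add_sum_erase _ _ h0s, ← hs] at hsum
  simp only [map_zero, Complex.exp_zero, mul_one] at hsum
  set P : Polynomial ℤ := ∏ α ∈ s, minpoly ℤ α with hP
  have hint : ∀ α : 𝓞 K, IsIntegral ℤ α := fun α => RingOfIntegers.isIntegral α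
  have hP0 : P.eval 0 ≠ 0 := by
    rw [hP, Polynomial.eval_prod, Finset.prod_ne_zero_iff]
    intro α hα
    rw [← Polynomial.coeff_zero_eq_eval_zero]
    have h1 := minpoly.isIntegrallyClosed_eq_field_fractions ℚ K (hint α)
    have h2 : (minpoly ℚ (algebraMap (𝓞 K) K α)).coeff 0 ≠ 0 := by
      apply minpoly.coeff_zero_ne_zero (Algebra.IsIntegral.isIntegral _)
      have h3 := Finset.ne_of_mem_erase hα
      simpa using h3
    intro h3
    apply h2
    rw [h1, Polynomial.coeff_map, h3, map_zero]
  have hPne : P ≠ 0 := by rintro h; simp [h] at hP0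
  let ψ : 𝓞 K →+* ℂ := φ.comp (algebraMap (𝓞 K) K)
  have hroot : ∀ α ∈ s, ψ α ∈ P.aroots ℂ := by
    intro α hα
    rw [Polynomial.mem_aroots]
    refine ⟨hPne, ?_⟩
    have h1 : Polynomial.aeval α P = 0 := by
      rw [hP, map_prod]
      exact Finset.prod_eq_zero hα (minpoly.aeval _ _)
    have h2 := congrArg ψ h1
    rw [map_zero] at h2
    rw [← h2, Polynomial.aeval_def, Polynomial.aeval_def, Polynomial.hom_eval₂]
    congr 1
    exact RingHom.ext_int _ _
  obtain ⟨C, hC⟩ := LindemannWeierstrass.exp_polynomial_approx P hP0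
  set B : ℝ := ∑ α ∈ s, |(c α : ℝ)| with hB
  have hlim : Filter.Tendsto (fun n : ℕ => B * (C * (C ^ n / (n.factorial : ℝ)))) Filter.atTop (nhds 0) := by
    have := ((FloorSemiring.tendsto_pow_div_factorial_atTop C).const_mul C).const_mul B
    simpa using this
  obtain ⟨N0, hN0⟩ := Filter.eventually_atTop.1 (hlim.eventually (gt_mem_nhds one_pos))
  obtain ⟨p, hp1, hp⟩ := Nat.exists_infinite_primes (N0 + 1 + (P.eval 0).natAbs + 1 + (c 0).natAbs + 1)
  obtain ⟨n, hpn, gp, -, hgp⟩ := hC p (by omega) hp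
  obtain ⟨N, hN⟩ := lw_fixed_int K (∑ α ∈ s, (c α : 𝓞 K) * Polynomial.aeval α gp) (by
    intro σ
    rw [Finset.smul_sum]
    refine Finset.sum_bij (fun α _ => σ • α) ?_ ?_ ?_ ?_
    · intro α hα
      simp only [hs, Finset.mem_erase, Finsupp.mem_support_iff] at hα ⊢
      rw [hinv]
      exact ⟨(smul_ne_zero_iff_ne σ).2 hα.1, hα.2⟩
    · intro a _ b _ hab
      exact MulAction.injective σ hab
    · intro b hb
      refine ⟨σ⁻¹ • b, ?_, by simp⟩
      simp only [hs, Finset.mem_erase, Finsupp.mem_support_iff] at hb ⊢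
      rw [hinv]
      exact ⟨(smul_ne_zero_iff_ne σ⁻¹).2 hb.1, hb.2⟩
    · intro α hα
      rw [hinv, smul_mul']
      congr 1
      · exact map_intCast (MulSemiringAction.toRingHom (K ≃ₐ[ℚ] K) (𝓞 K) σ) _
      · have := Polynomial.aeval_algHom_apply ((MulSemiringAction.toRingHom (K ≃ₐ[ℚ] K) (𝓞 K) σ).toIntAlgHom) α gp
        exact this.symm)
  have hNψ : ∑ α ∈ s, (c α : ℂ) * Polynomial.aeval (ψ α) gp = N := by
    have h2 := congrArg ψ hN
    rw [map_sum, map_intCast] at h2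
    rw [← h2]
    refine Finset.sum_congr rfl fun α _ => ?_
    rw [map_mul, map_intCast]
    congr 1
    exact Polynomial.aeval_algHom_apply ψ.toIntAlgHom α gp
  have key : ((n * c 0 + p * N : ℤ) : ℂ) =
      - ∑ α ∈ s, (c α : ℂ) * (n • Complex.exp (ψ α) - p • Polynomial.aeval (ψ α) gp) := by
    have e1 : ∑ α ∈ s, (c α : ℂ) * (n • Complex.exp (ψ α) - p • Polynomial.aeval (ψ α) gp)
        = n * ∑ α ∈ s, (c α : ℂ) * Complex.exp (φ α) - p * N := by
      rw [← hNψ, Finset.mul_sum, Finset.mul_sum, ← Finset.sum_sub_distrib]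
      refine Finset.sum_congr rfl fun α _ => ?_
      simp only [zsmul_eq_mul, nsmul_eq_mul]
      change _ = (n : ℂ) * (c α * Complex.exp (ψ α)) - _
      ring
    rw [e1, eq_neg_of_add_eq_zero_right hsum]
    push_cast
    ring
  have hbound : ‖((n * c 0 + p * N : ℤ) : ℂ)‖ < 1 := by
    rw [key, norm_neg]
    refine lt_of_le_of_lt (norm_sum_le _ _) ?_
    refine lt_of_le_of_lt (b := ∑ α ∈ s, |(c α : ℝ)| * (C ^ p / (p - 1).factorial)) ?_ ?_
    · refine Finset.sum_le_sum fun α hα => ?_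
      rw [norm_mul, Complex.norm_intCast]
      exact mul_le_mul_of_nonneg_left (hgp (hroot α hα)) (abs_nonneg _)
    · rw [← Finset.sum_mul, ← hB]
      have := hN0 (p - 1) (by omega)
      obtain ⟨q, rfl⟩ : ∃ q, p = q + 1 := ⟨p - 1, by omega⟩
      simp only [Nat.add_sub_cancel] at this ⊢
      rw [pow_succ']
      rwa [mul_div_assoc]
  rw [Complex.norm_intCast] at hbound
  have hz : n * c 0 + p * N = 0 := by
    rw [← Int.abs_lt_one_iff]
    exact_mod_cast hbound
  have hdvd : (p : ℤ) ∣ n * c 0 := ⟨-N, by linarith⟩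
  rcases (Nat.prime_iff_prime_int.1 hp).dvd_or_dvd hdvd with h | h
  · exact hpn h
  · have := Nat.le_of_dvd (Int.natAbs_pos.2 h0) (Int.natCast_dvd.1 h)
    omega

open NumberField in
lemma lw_field (K : Type*) [Field K] [NumberField K] [IsGalois ℚ K] (φ : K →+* ℂ)
    (c : 𝓞 K →₀ ℤ) (hsum : ∑ α ∈ c.support, (c α : ℂ) * Complex.exp (φ α) = 0) : c = 0 := by
  classical
  by_contra hc
  let E : Multiplicative (𝓞 K) →* ℂ :=
    { toFun := fun a => Complex.exp (φ ((Multiplicative.toAdd a : 𝓞 K) : K))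
      map_one' := by simp
      map_mul' := fun a b => by simp [Complex.exp_add] }
  let ev := AddMonoidAlgebra.lift ℤ ℂ (𝓞 K) E
  have hev : ∀ f, ev f = ∑ α ∈ f.coeff.support, (f.coeff α : ℂ) * Complex.exp (φ α) := by
    intro f
    simp only [ev, AddMonoidAlgebra.lift_apply, Finsupp.sum, zsmul_eq_mul]
    rfl
  let S : (K ≃ₐ[ℚ] K) → (AddMonoidAlgebra ℤ (𝓞 K) →+* AddMonoidAlgebra ℤ (𝓞 K)) := fun σ =>
    AddMonoidAlgebra.mapDomainRingHom ℤ (DistribSMul.toAddMonoidHom (𝓞 K) σ)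
  have hSs : ∀ σ a r, S σ (AddMonoidAlgebra.single a r) = AddMonoidAlgebra.single (σ • a) r := by
    intro σ a r
    simp [S]
  have hSS : ∀ σ τ f, S σ (S τ f) = S (σ * τ) f := by
    intro σ τ f
    change (S σ).comp (S τ) f = _
    congr 1
    simp only [S]
    rw [← AddMonoidAlgebra.mapDomainRingHom_comp]
    congr 1
  have hS1 : ∀ f, S 1 f = f := by
    intro f
    have : DistribSMul.toAddMonoidHom (𝓞 K) (1 : K ≃ₐ[ℚ] K) = AddMonoidHom.id _ := by
      ext x; simp
    simp only [S, this, AddMonoidAlgebra.mapDomainRingHom_id]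
    rfl
  have hSc : ∀ σ f α, (S σ f).coeff (σ • α) = f.coeff α := by
    intro σ f α
    exact Finsupp.mapDomain_apply (MulAction.injective σ) _ _
  let f : AddMonoidAlgebra ℤ (𝓞 K) := .ofCoeff c
  have hf : f ≠ 0 := by
    intro h
    apply hc
    exact congrArg AddMonoidAlgebra.coeff h
  have hevf : ev f = 0 := by rw [hev]; exact hsum
  let g := ∏ σ : K ≃ₐ[ℚ] K, S σ f
  have hg : g ≠ 0 := by
    refine Finset.prod_ne_zero_iff.2 fun σ _ h => hf ?_
    have := congrArg (S σ⁻¹) h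
    rwa [hSS, inv_mul_cancel, hS1, map_zero] at this
  have hevg : ev g = 0 := by
    simp only [g]
    rw [map_prod]
    exact Finset.prod_eq_zero (Finset.mem_univ 1) (by rw [hS1, hevf])
  have hgS : ∀ τ, S τ g = g := by
    intro τ
    simp only [g]
    rw [map_prod]
    simp only [hSS]
    exact Fintype.prod_equiv (Equiv.mulLeft τ) _ _ (fun σ => rfl)
  obtain ⟨α₀, hα₀⟩ : ∃ α, g.coeff α ≠ 0 := by
    by_contra! h
    apply hg
    ext α
    simpa using h α
  let u : AddMonoidAlgebra ℤ (𝓞 K) := ∑ σ : K ≃ₐ[ℚ] K, AddMonoidAlgebra.single (σ • (-α₀)) 1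
  have huS : ∀ τ, S τ u = u := by
    intro τ
    simp only [u]
    rw [map_sum]
    simp only [hSs, ← mul_smul]
    exact Fintype.sum_equiv (Equiv.mulLeft τ) _ _ (fun σ => rfl)
  refine lw_analytic K φ (g * u).coeff ?_ ?_ ?_
  · intro σ α
    have h1 : S σ (g * u) = g * u := by rw [map_mul, hgS, huS]
    conv_lhs => rw [← h1]
    exact hSc _ _ _
  · have hginv : ∀ (σ : K ≃ₐ[ℚ] K) α, g.coeff (σ • α) = g.coeff α := by
      intro σ α
      conv_lhs => rw [← hgS σ]
      exact hSc _ _ _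
    have : (g * u).coeff 0 = ∑ σ : K ≃ₐ[ℚ] K, g.coeff α₀ := by
      simp only [u]
      rw [Finset.mul_sum, AddMonoidAlgebra.coeff_sum, Finsupp.finsetSum_apply]
      refine Finset.sum_congr rfl fun σ _ => ?_
      rw [← hginv σ α₀]
      rw [AddMonoidAlgebra.coeff_mul_single_eq_coeff_mul (σ • α₀), mul_one]
      intro a _
      rw [smul_neg, add_neg_eq_zero]
    rw [this, Finset.sum_const, Finset.card_univ, smul_ne_zero_iff]
    exact ⟨Fintype.card_ne_zero, hα₀⟩
  · rw [← hev, map_mul, hevg, zero_mul]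

open NumberField in
lemma lw_linearIndependent {ι : Type*} (x : ι → ℂ) (hx : Function.Injective x)
    (hint : ∀ i, IsIntegral ℤ (x i)) : LinearIndependent ℤ (fun i => Complex.exp (x i)) := by
  classical
  rw [linearIndependent_iff']
  intro s g hg
  have hintQ : ∀ i, IsIntegral ℚ (x i) := fun i => (hint i).tower_top
  let L := IntermediateField.adjoin ℚ (x '' (s : Set ι))
  have : FiniteDimensional ℚ L := by
    have : Finite (x '' (s : Set ι)) := (s.finite_toSet.image x).to_subtype
    apply IntermediateField.finiteDimensional_adjoin
    rintro _ ⟨i, -, rfl⟩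
    exact hintQ i
  let K := IntermediateField.normalClosure ℚ L ℂ
  have : FiniteDimensional ℚ K := normalClosure.is_finiteDimensional ℚ L ℂ
  have : NumberField K := { to_charZero := inferInstance, to_finiteDimensional := inferInstance }
  have : IsNormalClosure ℚ L K :=
    Algebra.IsAlgebraic.isNormalClosure_normalClosure (fun _ => IsAlgClosed.splits _)
  have : Normal ℚ K := IsNormalClosure.normal (K := L)
  have : IsGalois ℚ K := ⟨⟩
  have hmem : ∀ i ∈ s, x i ∈ K := by
    intro i hi
    have h1 : x i ∈ L := IntermediateField.subset_adjoin _ _ ⟨i, hi, rfl⟩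
    exact AlgHom.fieldRange_le_normalClosure L.val ⟨⟨x i, h1⟩, rfl⟩
  have hy : ∀ i : s, ∃ y : 𝓞 K, ((y : K) : ℂ) = x i := by
    intro i
    have h1 : IsIntegral ℤ (⟨x i, hmem i i.2⟩ : K) := by
      have h2 : IsIntegral ℤ (algebraMap K ℂ ⟨x i, hmem i i.2⟩) := hint i
      exact (isIntegral_algebraMap_iff (algebraMap K ℂ).injective).1 h2
    exact ⟨⟨_, h1⟩, rfl⟩
  choose y hy using hy
  have hyinj : Function.Injective y := by
    intro i j hij
    apply Subtype.ext
    apply hx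
    rw [← hy, ← hy, hij]
  let c : 𝓞 K →₀ ℤ := ∑ i : s, Finsupp.single (y i) (g i)
  have hc : c = 0 := by
    apply lw_field K (algebraMap K ℂ)
    change c.sum (fun α r => (r : ℂ) * Complex.exp (algebraMap K ℂ α)) = 0
    rw [← Finsupp.sum_finsetSum_index]
    · rw [← hg, ← Finset.sum_coe_sort s]
      refine Finset.sum_congr rfl fun i _ => ?_
      rw [Finsupp.sum_single_index (by simp), zsmul_eq_mul, ← hy]
      rfl
    · simp
    · intro a b₁ b₂
      push_cast
      ring
  intro i hi
  have h1 : c (y ⟨i, hi⟩) = g i := by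
    simp only [c, Finsupp.finsetSum_apply, Finsupp.single_apply, hyinj.eq_iff]
    simp
  rw [← h1, hc]
  rfl

lemma lw_log_two : Transcendental ℚ (Real.log 2) := by
  intro h
  have h' : IsAlgebraic ℤ (Real.log 2) := (IsFractionRing.isAlgebraic_iff ℤ ℚ ℝ).2 h
  obtain ⟨k, hk, hki⟩ := h'.exists_integral_multiple
  have hn : IsIntegral ℤ ((k.natAbs : ℝ) * Real.log 2) := by
    rw [zsmul_eq_mul] at hki
    rcases Int.natAbs_eq k with h1 | h1
    · rw [h1, Int.cast_natCast] at hki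
      exact hki
    · rw [h1, Int.cast_neg, Int.cast_natCast, neg_mul] at hki
      exact (neg_neg ((k.natAbs : ℝ) * Real.log 2)) ▸ hki.neg
  set n := k.natAbs with hndef
  have hn0 : n ≠ 0 := Int.natAbs_ne_zero.2 hk
  have hlog : Real.log 2 ≠ 0 := (Real.log_pos (by norm_num)).ne'
  have hne : (((n : ℝ) * Real.log 2 : ℝ) : ℂ) ≠ 0 := by
    rw [Complex.ofReal_ne_zero]
    exact mul_ne_zero (by exact_mod_cast hn0) hlog
  have hli := lw_linearIndependent ![(0 : ℂ), (((n : ℝ) * Real.log 2 : ℝ) : ℂ)]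
    (by
      intro i j hij
      fin_cases i <;> fin_cases j <;> simp_all)
    (by
      intro i
      fin_cases i
      · exact isIntegral_zero
      · exact hn.map (Complex.ofRealHom.toIntAlgHom))
  rw [Fintype.linearIndependent_iff] at hli
  have := hli ![2 ^ n, -1] (by
    have e : Complex.exp (((n : ℝ) * Real.log 2 : ℝ) : ℂ) = 2 ^ n := by
      rw [← Complex.ofReal_exp, Real.exp_nat_mul, Real.exp_log (by norm_num)]
      push_cast
      rfl
    simp only [Fin.sum_univ_two, Matrix.cons_val_zero, Matrix.cons_val_one, e]
    simp) 1
  simp at this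

lemma lw_indep : AlgebraicIndependent ℚ ![Real.exp 1, Real.exp (√2)] := by
  have hli := lw_linearIndependent (fun m : Fin 2 →₀ ℕ => (((m 0 : ℝ) + m 1 * √2 : ℝ) : ℂ))
    (by
      intro a b hab
      have h1 : (a 0 : ℝ) + a 1 * √2 = b 0 + b 1 * √2 := Complex.ofReal_injective hab
      have h2 : a 1 = b 1 := by
        by_contra hne
        have h3 : (a 1 : ℝ) - b 1 ≠ 0 := by
          rw [sub_ne_zero]; exact_mod_cast hne
        apply irrational_sqrt_two
        refine ⟨((b 0 : ℚ) - a 0) / (a 1 - b 1), ?_⟩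
        push_cast
        rw [div_eq_iff h3]
        linarith
      have h3 : a 0 = b 0 := by
        rw [h2] at h1
        exact_mod_cast add_right_cancel h1
      ext i
      fin_cases i
      · exact h3
      · exact h2)
    (by
      intro m
      have hs : IsIntegral ℤ (√2 : ℝ) := by
        refine IsIntegral.of_pow (n := 2) (by norm_num) ?_
        rw [Real.sq_sqrt (by norm_num)]
        exact isIntegral_algebraMap (R := ℤ) (x := 2)
      have hn : ∀ n : ℕ, IsIntegral ℤ (n : ℝ) := fun n => by
        exact_mod_cast isIntegral_algebraMap (R := ℤ) (A := ℝ) (x := (n : ℤ))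
      exact ((hn (m 0)).add ((hn (m 1)).mul hs)).map (Complex.ofRealHom.toIntAlgHom))
  rw [LinearIndependent.iff_fractionRing ℤ ℚ, linearIndependent_iff'] at hli
  rw [algebraicIndependent_iff]
  intro F hF
  have h0 := hli F.support (fun m => F.coeff m) (by
    rw [MvPolynomial.aeval_def, MvPolynomial.eval₂_eq'] at hF
    have := congrArg (fun r : ℝ => (r : ℂ)) hF
    simp only [Complex.ofReal_sum, Complex.ofReal_zero] at this
    rw [← this]
    refine Finset.sum_congr rfl fun m _ => ?_
    rw [← Complex.ofReal_exp, Real.exp_add, Real.exp_nat_mul, ← mul_one (m 0 : ℝ), Real.exp_nat_mul]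
    simp [Fin.prod_univ_two, Algebra.smul_def])
  ext m
  by_cases hm : m ∈ F.support
  · simpa using h0 m hm
  · simpa using hm

lemma mem_Lset_iff (x : ℝ) : x ∈ Lset ↔ ¬ AlgebraicIndependent ℚ ![x, Real.exp x] := by
  rw [algebraicIndependent_iff]
  push Not
  simp only [Lset, Set.mem_ofPred_eq]
  exact exists_congr fun F => and_comm

lemma mem_Lset_of_isAlgebraic (x : ℝ) (h : IsAlgebraic ℚ x) : x ∈ Lset := by
  rw [mem_Lset_iff]
  intro hi
  exact hi.transcendental 0 h

lemma log_two_mem_Lset : Real.log 2 ∈ Lset := by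
  rw [mem_Lset_iff, Real.exp_log (by norm_num)]
  intro hi
  apply hi.transcendental 1
  exact_mod_cast isAlgebraic_algebraMap (R := ℚ) (A := ℝ) 2

lemma exp_mem_closure (a : ℝ) (ha : IsAlgebraic ℚ a) (h : a + Real.log 2 ∈ Lset) :
    Real.exp a ∈ (AlgebraicIndependent.matroid ℚ ℝ).closure {Real.log 2} := by
  set M := AlgebraicIndependent.matroid ℚ ℝ
  set t := Real.log 2 with ht
  have hcl : ∀ s : Set ℝ, M.closure s = Subalgebra.algebraicClosure (Algebra.adjoin ℚ s) ℝ :=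
    fun s => AlgebraicIndependent.matroid_closure_eq
  have halg : ∀ (s : Set ℝ) (x : ℝ), IsAlgebraic ℚ x → x ∈ M.closure s := by
    intro s x hx
    rw [hcl]
    exact hx.extendScalars (algebraMap ℚ (Algebra.adjoin ℚ s)).injective
  have hadd : ∀ (s : Set ℝ) (x y : ℝ), x ∈ M.closure s → y ∈ M.closure s → x + y ∈ M.closure s := by
    intro s x y hx hy
    rw [hcl] at *
    exact add_mem hx hy
  have hmul : ∀ (s : Set ℝ) (x y : ℝ), x ∈ M.closure s → y ∈ M.closure s → x * y ∈ M.closure s := by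
    intro s x y hx hy
    rw [hcl] at *
    exact mul_mem hx hy
  have htM : t ∈ M.closure {t} := M.mem_closure_of_mem rfl
  have hx : a + t ∈ M.closure {t} := hadd _ _ _ (halg _ _ ha) htM
  have hxt : Transcendental ℚ (a + t) := by
    intro h1
    apply lw_log_two
    have := h1.sub ha
    simpa using this
  have hI : M.Indep {a + t} := by
    rw [AlgebraicIndependent.matroid_indep_iff]
    exact (algebraicIndependent_singleton_iff (⟨a + t, rfl⟩ : ({a + t} : Set ℝ))).2 hxt
  have hy : Real.exp (a + t) ∈ M.closure {a + t} := by
    rw [hI.mem_closure_iff']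
    refine ⟨trivial, fun h1 => ?_⟩
    by_contra h2
    rw [mem_Lset_iff] at h
    apply h
    rw [AlgebraicIndependent.matroid_indep_iff] at h1
    let f : Fin 2 → (insert (Real.exp (a + t)) {a + t} : Set ℝ) :=
      ![⟨a + t, by simp⟩, ⟨Real.exp (a + t), by simp⟩]
    have hf : Function.Injective f := by
      have h3 : Real.exp (a + t) ≠ a + t := h2
      have h4 := h3.symm
      intro i j hij
      fin_cases i <;> fin_cases j <;> simp_all [f]
    have := AlgebraicIndependent.comp h1 f hf
    convert this using 1
    ext i
    fin_cases i <;> rfl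
  have hy2 : Real.exp (a + t) ∈ M.closure {t} := by
    have : M.closure {a + t} ⊆ M.closure {t} :=
      M.closure_subset_closure_of_subset_closure (by simpa using hx)
    exact this hy
  have : Real.exp a = (1 / 2) * Real.exp (a + t) := by
    rw [Real.exp_add, ht, Real.exp_log (by norm_num)]
    ring
  rw [this]
  refine hmul _ _ _ (halg _ _ ?_) hy2
  have := isAlgebraic_algebraMap (R := ℚ) (A := ℝ) (1 / 2)
  simpa using this

theorem Lset_not_add_closed :
    Real.log 2 ∈ Lset ∧ ¬ (∀ x ∈ Lset, ∀ y ∈ Lset, x + y ∈ Lset) := by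
  refine ⟨log_two_mem_Lset, fun h => ?_⟩
  have h1 : IsAlgebraic ℚ (1 : ℝ) := isAlgebraic_one
  have h2 : IsAlgebraic ℚ (√2 : ℝ) := by
    refine IsAlgebraic.of_pow (n := 2) (by norm_num) ?_
    rw [Real.sq_sqrt (by norm_num)]
    exact_mod_cast isAlgebraic_algebraMap (R := ℚ) (A := ℝ) 2
  have e1 := exp_mem_closure _ h1 (h _ (mem_Lset_of_isAlgebraic _ h1) _ log_two_mem_Lset)
  have e2 := exp_mem_closure _ h2 (h _ (mem_Lset_of_isAlgebraic _ h2) _ log_two_mem_Lset)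
  set M := AlgebraicIndependent.matroid ℚ ℝ
  have hI : M.Indep (Set.range ![Real.exp 1, Real.exp (√2)]) :=
    lw_indep.to_subtype_range
  have hsub : Set.range ![Real.exp 1, Real.exp (√2)] ⊆ M.closure {Real.log 2} := by
    rintro _ ⟨i, rfl⟩
    fin_cases i
    · exact e1
    · exact e2
  have hle := hI.encard_le_eRk_of_subset hsub
  rw [M.eRk_closure_eq] at hle
  have hle2 := hle.trans (M.eRk_le_encard _)
  rw [Set.encard_singleton, ← Set.image_univ, lw_indep.injective.encard_image] at hle2
  simp at hle2
end

section
/- Let f, g : (a,b) → ℝ be continuous, let (f₀, …, f_N) be a Sturm sequence for f with respect to g, and let t ∈ (a,b) with f₀(t) = 0. Then for sufficiently small ε > 0 the variation count v(x) of (f₀(x),…,f_N(x)) satisfies: if g(t) > 0, then v(x) = v(t) + 1 for x ∈ (t−ε, t) and v(x) = v(t) for x ∈ [t, t+ε); if g(t) < 0, then v(x) = v(t) for x ∈ (t−ε, t] and v(x) = v(t) + 1 for x ∈ (t, t+ε). -/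
open Set

noncomputable section

/-- Number of sign changes between consecutive entries of a list of reals. -/
def signChanges : List ℝ → ℕ
  | a :: b :: t => (if a * b < 0 then 1 else 0) + signChanges (b :: t)
  | _ => 0

/-- Number of sign variations of a tuple of reals, after removing zero entries. -/
def signVar (l : List ℝ) : ℕ :=
  signChanges (l.filter (fun x => decide (x ≠ 0)))

/-- `v N F x` is the number of sign variations in `(F 0 x, …, F N x)` after removing zeros. -/
def v (N : ℕ) (F : ℕ → ℝ → ℝ) (x : ℝ) : ℕ :=
  signVar ((List.range (N + 1)).map (fun i => F i x))

/-- `(F 0, …, F N)` is a Sturm sequence in `(a,b)` for `f` with respect to `g`. -/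
def SturmSeq (a b : ℝ) (f g : ℝ → ℝ) (N : ℕ) (F : ℕ → ℝ → ℝ) : Prop :=
  (∀ i ≤ N, ContinuousOn (F i) (Ioo a b)) ∧
  (∀ y ∈ Ioo a b, (F 0 y = 0 ↔ (f y = 0 ∧ g y ≠ 0))) ∧
  (∀ y ∈ Ioo a b, F 0 y = 0 →
    ∃ ε > 0, (∀ x ∈ Ioo (y - ε) (y + ε), F 1 x ≠ 0) ∧
      (g y > 0 →
        (∀ x ∈ Ioo (y - ε) y, F 0 x * F 1 x < 0) ∧
        (∀ x ∈ Ioo y (y + ε), F 0 x * F 1 x > 0)) ∧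
      (g y < 0 →
        (∀ x ∈ Ioo (y - ε) y, F 0 x * F 1 x > 0) ∧
        (∀ x ∈ Ioo y (y + ε), F 0 x * F 1 x < 0))) ∧
  (∀ y ∈ Ioo a b, ∀ i, 1 ≤ i → i ≤ N - 1 → F i y = 0 → F (i - 1) y * F (i + 1) y < 0) ∧
  (∀ y ∈ Ioo a b, F N y ≠ 0)

theorem signVar_zero_cons (l : List ℝ) : signVar (0 :: l) = signVar l := by
  simp [signVar]

theorem signVar_cons_cons {p q : ℝ} (hp : p ≠ 0) (hq : q ≠ 0) (l : List ℝ) :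
    signVar (p :: q :: l) = (if p * q < 0 then 1 else 0) + signVar (q :: l) := by
  simp [signVar, hp, hq, signChanges]

theorem signVar_three {p q r : ℝ} (h : p * r < 0) (l : List ℝ) :
    signVar (p :: q :: r :: l) = 1 + signVar (r :: l) := by
  have hp : p ≠ 0 := by rintro rfl; simp at h
  have hr : r ≠ 0 := by rintro rfl; simp at h
  by_cases hq : q = 0
  · subst hq
    simp [signVar, hp, hr, signChanges, h]
  · rw [signVar_cons_cons hp hq, signVar_cons_cons hq hr]
    have key : ((if p * q < 0 then 1 else 0) + (if q * r < 0 then 1 else 0) : ℕ) = 1 := by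
      rcases lt_or_gt_of_ne hp with hp | hp <;> rcases lt_or_gt_of_ne hq with hq | hq <;>
        rcases lt_or_gt_of_ne hr with hr | hr <;>
        simp [mul_neg_iff, hp, hq, hr, hp.le, hq.le, hr.le, hp.not_gt, hq.not_gt, hr.not_gt] <;>
        nlinarith
    omega

theorem tail_const {N : ℕ} {F : ℕ → ℝ → ℝ} {t : ℝ}
    (hc : ∀ i ≤ N, ContinuousAt (F i) t)
    (h3 : ∀ i, 1 ≤ i → i ≤ N - 1 → F i t = 0 → F (i - 1) t * F (i + 1) t < 0)
    (h4 : F N t ≠ 0) (n : ℕ) : ∀ k, k + n = N → F k t ≠ 0 →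
    ∀ᶠ x in nhds t, signVar ((List.range' k (n + 1)).map (fun i => F i x)) =
      signVar ((List.range' k (n + 1)).map (fun i => F i t)) := by
  induction n using Nat.strong_induction_on with
  | _ n ih =>
  intro k hk hkt
  match n, ih, hk with
  | 0, ih, hk =>
    filter_upwards with x
    by_cases hx : F k x = 0 <;> simp [signVar, signChanges, hx, hkt]
  | m + 1, ih, hk =>
    have ck := hc k (by omega)
    have ck1 := hc (k + 1) (by omega)
    by_cases h1 : F (k + 1) t = 0
    · match m, ih, hk with
      | 0, ih, hk =>
        have : k + 1 = N := by omega
        exact absurd (this ▸ h1) h4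
      | j + 1, ih, hk =>
        have hneg : F k t * F (k + 2) t < 0 := h3 (k + 1) (by omega) (by omega) h1
        have ck2 := hc (k + 2) (by omega)
        have h2 : F (k + 2) t ≠ 0 := fun h => by simp [h] at hneg
        have e := (ck.mul ck2).eventually_lt_const hneg
        filter_upwards [e, ih j (by omega) (k + 2) (by omega) h2] with x hx hi
        have hx : F k x * F (k + 2) x < 0 := hx
        simp only [List.range'_succ, List.map_cons] at hi ⊢
        rw [signVar_three hx, signVar_three hneg, hi]
    · have i1 := ih m (by omega) (k + 1) (by omega) h1
      have e : ∀ᶠ x in nhds t, (F k x * F (k + 1) x < 0 ↔ F k t * F (k + 1) t < 0) := by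
        rcases lt_or_gt_of_ne (mul_ne_zero hkt h1) with h | h
        · filter_upwards [(ck.mul ck1).eventually_lt_const h] with x hx
          exact iff_of_true hx h
        · filter_upwards [(ck.mul ck1).eventually_const_lt h] with x hx
          exact iff_of_false (not_lt.2 (le_of_lt hx)) h.not_gt
      filter_upwards [e, i1, ck.eventually_ne hkt, ck1.eventually_ne h1] with x hx hi ha hb
      simp only [List.range'_succ, List.map_cons] at hi ⊢
      rw [signVar_cons_cons ha hb, signVar_cons_cons hkt h1, hi]
      simp only [hx]

theorem variation_jump_at_zero {a b : ℝ} {N : ℕ} {f g : ℝ → ℝ} {F : ℕ → ℝ → ℝ}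
    (hf : ContinuousOn f (Ioo a b)) (hg : ContinuousOn g (Ioo a b))
    (hSturm : SturmSeq a b f g N F)
    {t : ℝ} (ht : t ∈ Ioo a b) (h0 : F 0 t = 0) :
    ∃ ε > 0, Ioo (t - ε) (t + ε) ⊆ Ioo a b ∧
      (g t > 0 →
        (∀ x ∈ Ioo (t - ε) t, v N F x = v N F t + 1) ∧
        (∀ x ∈ Ico t (t + ε), v N F x = v N F t)) ∧
      (g t < 0 →
        (∀ x ∈ Ioc (t - ε) t, v N F x = v N F t) ∧
        (∀ x ∈ Ioo t (t + ε), v N F x = v N F t + 1)) := by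
  obtain ⟨hc, -, h2, h3, h4⟩ := hSturm
  obtain ⟨δ, hδ, hne, hpos, hneg⟩ := h2 t ht h0
  have hmem : Ioo a b ∈ nhds t := isOpen_Ioo.mem_nhds ht
  obtain ⟨n, rfl⟩ : ∃ n, N = n + 1 := by
    cases N with
    | zero => exact absurd h0 (h4 t ht)
    | succ n => exact ⟨n, rfl⟩
  have h1t : F 1 t ≠ 0 := hne t ⟨by linarith, by linarith⟩
  have hT := tail_const (fun i hi => (hc i hi).continuousAt hmem) (h3 t ht) (h4 t ht) n 1
    (by omega) h1t
  obtain ⟨η, hη, hball⟩ := Metric.eventually_nhds_iff.1 (hT.and hmem)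
  have hvt : v (n + 1) F t = signVar ((List.range' 1 (n + 1)).map (fun i => F i t)) := by
    unfold v
    rw [List.range_eq_range', List.range'_succ, List.map_cons, h0, signVar_zero_cons]
  have hv : ∀ x ∈ Ioo (t - min δ η) (t + min δ η), F 0 x * F 1 x ≠ 0 →
      v (n + 1) F x = (if F 0 x * F 1 x < 0 then 1 else 0) + v (n + 1) F t := by
    intro x hx hxx
    have hd : dist x t < η := by
      rw [Real.dist_eq, abs_lt]
      constructor <;> linarith [hx.1, hx.2, min_le_right δ η]
    have := (hball hd).1
    rw [hvt, ← this]
    unfold v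
    rw [List.range_eq_range', List.range'_succ]
    simp only [List.range'_succ, List.map_cons]
    exact signVar_cons_cons (left_ne_zero_of_mul hxx) (right_ne_zero_of_mul hxx) _
  have hle := min_le_left δ η
  refine ⟨min δ η, lt_min hδ hη, ?_, ?_, ?_⟩
  · intro x hx
    apply (hball _).2
    rw [Real.dist_eq, abs_lt]
    constructor <;> linarith [hx.1, hx.2, min_le_right δ η]
  · intro hg
    obtain ⟨hl, hr⟩ := hpos hg
    refine ⟨fun x hx => ?_, fun x hx => ?_⟩
    · have h := hl x ⟨by linarith [hx.1], hx.2⟩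
      rw [hv x ⟨hx.1, by linarith [hx.1, hx.2]⟩ h.ne, if_pos h, add_comm]
    · rcases hx.1.eq_or_lt with rfl | hlt
      · rfl
      have h := hr x ⟨hlt, by linarith [hx.2]⟩
      rw [hv x ⟨by linarith [hx.1, hx.2], hx.2⟩ h.ne', if_neg h.not_gt, zero_add]
  · intro hg
    obtain ⟨hl, hr⟩ := hneg hg
    refine ⟨fun x hx => ?_, fun x hx => ?_⟩
    · rcases hx.2.eq_or_lt with rfl | hlt
      · rfl
      have h := hl x ⟨by linarith [hx.1], hlt⟩
      rw [hv x ⟨hx.1, by linarith [hx.1, hx.2]⟩ h.ne', if_neg h.not_gt, zero_add]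
    · have h := hr x ⟨hx.1, by linarith [hx.2]⟩
      rw [hv x ⟨by linarith [hx.1, hx.2], hx.2⟩ h.ne, if_pos h, add_comm]

end
end
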